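/- arXiv:2203.16412 — 5 statements merged into one kernel-verified Lean document; each statement's English description precedes it below -/
import Mathlib

section
/- Let E ⊆ EuclideanSpace ℝ (Fin q) and let B be a map from E to (EuclideanSpace ℝ (Fin k)) →ₗ[ℝ] (EuclideanSpace ℝ (Fin q)); let P_y and A y be the associated affine planes and linear maps. Then for all distinct x, y ∈ E, the affine subspaces P_x and P_y are skew (disjoint with trivially intersecting directions) if and only if the kernel of the linear map A x − A y is trivial, i.e., (B x − B y) t + λ • (x − y) = 0 only when t = 0 and λ = 0. -/
open Metric Module

/-- The affine `k`-plane `P_y = {(t, B y t + y) : t}` associated to a map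
`B` into the space of linear maps. -/
noncomputable def plane {q k : ℕ}
    (B : EuclideanSpace ℝ (Fin q) → (EuclideanSpace ℝ (Fin k) →ₗ[ℝ] EuclideanSpace ℝ (Fin q)))
    (y : EuclideanSpace ℝ (Fin q)) :
    AffineSubspace ℝ (EuclideanSpace ℝ (Fin k) × EuclideanSpace ℝ (Fin q)) :=
  AffineSubspace.mk' (0, y) (LinearMap.graph (B y))

theorem mem_plane_iff {q k : ℕ}
    {B : EuclideanSpace ℝ (Fin q) → (EuclideanSpace ℝ (Fin k) →ₗ[ℝ] EuclideanSpace ℝ (Fin q))}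
    {y : EuclideanSpace ℝ (Fin q)} {p : EuclideanSpace ℝ (Fin k) × EuclideanSpace ℝ (Fin q)} :
    p ∈ plane B y ↔ p.2 = B y p.1 + y := by
  simp [plane, AffineSubspace.mem_mk', LinearMap.mem_graph_iff, sub_eq_iff_eq_add]

theorem direction_plane {q k : ℕ}
    (B : EuclideanSpace ℝ (Fin q) → (EuclideanSpace ℝ (Fin k) →ₗ[ℝ] EuclideanSpace ℝ (Fin q)))
    (y : EuclideanSpace ℝ (Fin q)) :
    (plane B y).direction = LinearMap.graph (B y) :=
  AffineSubspace.direction_mk' _ _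

theorem skew_iff_kernel_trivial (q k : ℕ) (E : Set (EuclideanSpace ℝ (Fin q)))
    (B : EuclideanSpace ℝ (Fin q) → (EuclideanSpace ℝ (Fin k) →ₗ[ℝ] EuclideanSpace ℝ (Fin q))) :
    ∀ x ∈ E, ∀ y ∈ E, x ≠ y →
      ((Disjoint (plane B x : Set (EuclideanSpace ℝ (Fin k) × EuclideanSpace ℝ (Fin q)))
          (plane B y : Set (EuclideanSpace ℝ (Fin k) × EuclideanSpace ℝ (Fin q))) ∧
        (plane B x).direction ⊓ (plane B y).direction = ⊥) ↔
      (∀ (t : EuclideanSpace ℝ (Fin k)) (lam : ℝ),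
        (B x - B y) t + lam • (x - y) = 0 → t = 0 ∧ lam = 0)) := by
  intro x _ y _ _
  rw [direction_plane, direction_plane, Set.disjoint_left, Submodule.eq_bot_iff]
  constructor
  · rintro ⟨hdisj, hdir⟩ t lam h
    have hlam : lam = 0 := by
      by_contra hlam
      have h0 : (B x - B y) (lam⁻¹ • t) + (x - y) = 0 := by
        have := congrArg (lam⁻¹ • ·) h
        simpa only [smul_add, smul_zero, ← map_smul, inv_smul_smul₀ hlam] using this
      refine hdisj (a := (lam⁻¹ • t, B x (lam⁻¹ • t) + x)) (mem_plane_iff.2 rfl)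
        (mem_plane_iff.2 (sub_eq_zero.1 ?_))
      rw [← h0, LinearMap.sub_apply, sub_add_sub_comm]
    subst hlam
    have h0 : B x t = B y t := by
      simpa [sub_eq_zero] using h
    exact ⟨congrArg Prod.fst (hdir (t, B x t) ⟨((B x).mem_graph_iff _).2 rfl,
      ((B y).mem_graph_iff _).2 h0⟩), rfl⟩
  · intro h
    refine ⟨fun p hx hy => ?_, ?_⟩
    · have hp : B x p.1 + x = B y p.1 + y := (mem_plane_iff.1 hx).symm.trans (mem_plane_iff.1 hy)
      refine one_ne_zero (h p.1 1 ?_).2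
      rw [one_smul, LinearMap.sub_apply, sub_add_sub_comm, hp, sub_self]
    · rintro ⟨t, s⟩ ⟨hx, hy⟩
      have hx' : s = B x t := ((B x).mem_graph_iff _).1 hx
      have hy' : s = B y t := ((B y).mem_graph_iff _).1 hy
      have ht : t = 0 := (h t 0 (by simp [← hx', ← hy'])).1
      simp [hx', ht]
end

section
/- Let k, q ≥ 1 and suppose there exists a nonsingular bilinear map β : ℝ^q × ℝ^(k+1) → ℝ^q. Then there exists a family (Q_y), indexed by y ∈ EuclideanSpace ℝ (Fin q), of affine subspaces of (EuclideanSpace ℝ (Fin k)) × (EuclideanSpace ℝ (Fin q)), each of whose directions has dimension k, such that the Q_y are pairwise skew and their union is the whole space; that is, ℝ^(k+q) admits a fibration by pairwise skew affine k-planes. -/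
open Metric Module

/-- The linear inclusion `x ↦ (0, x)` of `ℝ^k` into `ℝ^(k+1)`. -/
noncomputable def consZero (k : ℕ) :
    EuclideanSpace ℝ (Fin k) →ₗ[ℝ] EuclideanSpace ℝ (Fin (k + 1)) where
  toFun x := WithLp.toLp 2 (Fin.cons 0 x.ofLp)
  map_add' x y := by
    ext i
    refine Fin.cases ?_ (fun j => ?_) i <;> simp
  map_smul' c x := by
    ext i
    refine Fin.cases ?_ (fun j => ?_) i <;> simp

lemma consZero_injective (k : ℕ) : Function.Injective (consZero k) := by
  intro x y h
  ext j
  simpa [consZero] using congrArg (fun v => v.ofLp j.succ) h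

lemma single_add_consZero_ne_zero {k : ℕ} (x : EuclideanSpace ℝ (Fin k)) :
    EuclideanSpace.single 0 (1 : ℝ) + consZero k x ≠ 0 := by
  intro h
  simpa [consZero] using congrArg (fun v => v.ofLp 0) h

/-- The affine subspace `{(x, c + L x)}`, the graph of the affine map `x ↦ c + L x`. -/
def affineGraph {V W : Type*} [AddCommGroup V] [Module ℝ V] [AddCommGroup W] [Module ℝ W]
    (c : W) (L : V →ₗ[ℝ] W) : AffineSubspace ℝ (V × W) :=
  AffineSubspace.mk' (0, c) L.graph

lemma mem_affineGraph {V W : Type*} [AddCommGroup V] [Module ℝ V] [AddCommGroup W] [Module ℝ W]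
    {c : W} {L : V →ₗ[ℝ] W} {p : V × W} : p ∈ affineGraph c L ↔ p.2 = c + L p.1 := by
  simp [affineGraph, AffineSubspace.mem_mk', LinearMap.mem_graph_iff, sub_eq_iff_eq_add']

lemma direction_affineGraph {V W : Type*} [AddCommGroup V] [Module ℝ V] [AddCommGroup W]
    [Module ℝ W] (c : W) (L : V →ₗ[ℝ] W) : (affineGraph c L).direction = L.graph :=
  AffineSubspace.direction_mk' _ _

lemma finrank_graph {V W : Type*} [AddCommGroup V] [Module ℝ V] [AddCommGroup W]
    [Module ℝ W] (L : V →ₗ[ℝ] W) : finrank ℝ L.graph = finrank ℝ V := by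
  rw [LinearMap.graph_eq_range_prod]
  exact LinearMap.finrank_range_of_inj fun x y h => congrArg Prod.fst h

theorem nonsingular_bilinear_gives_skew_fibration (k q : ℕ) (hk : 1 ≤ k) (hq : 1 ≤ q)
    (β : EuclideanSpace ℝ (Fin q) →ₗ[ℝ]
      (EuclideanSpace ℝ (Fin (k + 1)) →ₗ[ℝ] EuclideanSpace ℝ (Fin q)))
    (hβ : ∀ (ξ : EuclideanSpace ℝ (Fin q)) (w : EuclideanSpace ℝ (Fin (k + 1))),
      β ξ w = 0 → ξ = 0 ∨ w = 0) :
    ∃ Q : EuclideanSpace ℝ (Fin q) →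
        AffineSubspace ℝ (EuclideanSpace ℝ (Fin k) × EuclideanSpace ℝ (Fin q)),
      (∀ y, finrank ℝ (Q y).direction = k) ∧
      (∀ y y' : EuclideanSpace ℝ (Fin q), y ≠ y' →
        Disjoint (Q y : Set (EuclideanSpace ℝ (Fin k) × EuclideanSpace ℝ (Fin q)))
          (Q y' : Set (EuclideanSpace ℝ (Fin k) × EuclideanSpace ℝ (Fin q))) ∧
        (Q y).direction ⊓ (Q y').direction = ⊥) ∧
      (∀ p : EuclideanSpace ℝ (Fin k) × EuclideanSpace ℝ (Fin q),
        ∃ y : EuclideanSpace ℝ (Fin q), p ∈ Q y) := by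
  have inj : ∀ {w}, w ≠ 0 → Function.Injective (β.flip w) := fun {w} hw =>
    (injective_iff_map_eq_zero _).2 fun ξ h => (hβ ξ w h).resolve_right hw
  refine ⟨fun y => affineGraph (β y (EuclideanSpace.single 0 1)) (β y ∘ₗ consZero k),
    fun y => ?_, fun y y' hy => ⟨?_, ?_⟩, fun p => ?_⟩
  · rw [direction_affineGraph, finrank_graph, finrank_euclideanSpace_fin]
  · refine Set.disjoint_left.2 fun p hp hp' => hy (inj (single_add_consZero_ne_zero p.1) ?_)
    rw [SetLike.mem_coe, mem_affineGraph] at hp hp'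
    simpa using hp.symm.trans hp'
  · rw [direction_affineGraph, direction_affineGraph, Submodule.eq_bot_iff]
    rintro ⟨x, z⟩ ⟨h, h'⟩
    rw [SetLike.mem_coe, LinearMap.mem_graph_iff] at h h'
    have hx : x = 0 := by
      by_contra hx
      exact hy (inj ((map_ne_zero_iff _ (consZero_injective k)).2 hx) (h.symm.trans h'))
    subst hx
    simpa using h
  · obtain ⟨y, hy⟩ := LinearMap.injective_iff_surjective.1
      (inj (single_add_consZero_ne_zero p.1)) p.2
    exact ⟨y, mem_affineGraph.2 (by simpa using hy.symm)⟩
end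

section
/- For every m ≥ 2 there exists a linear map B : EuclideanSpace ℝ (Fin (2m)) →ₗ[ℝ] EuclideanSpace ℝ (Fin (2m)) such that: (i) B has no real eigenvalues, i.e., for every μ ∈ ℝ and every v ≠ 0, B v ≠ μ • v; (ii) the lines L_y = {(t, y + t • (B y)) : t ∈ ℝ} ⊂ ℝ × ℝ^(2m), y ∈ ℝ^(2m), are pairwise skew and their union is all of ℝ × ℝ^(2m) (so B determines a smooth nondegenerate line fibration of ℝ^(2m+1)); and (iii) B − B†, where B† denotes the adjoint of B with respect to the standard inner product, is not injective. (Condition (iii) expresses that the hyperplane distribution orthogonal to this line fibration fails to be a contact structure at the origin.) -/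
open Metric Module

/-- The line `L_y = {(t, y + t • B y) : t ∈ ℝ}` in `ℝ × ℝ^(2m)`. -/
noncomputable def lineFiber {m : ℕ}
    (B : EuclideanSpace ℝ (Fin (2 * m)) →ₗ[ℝ] EuclideanSpace ℝ (Fin (2 * m)))
    (y : EuclideanSpace ℝ (Fin (2 * m))) :
    AffineSubspace ℝ (ℝ × EuclideanSpace ℝ (Fin (2 * m))) :=
  AffineSubspace.mk' ((0 : ℝ), y) (Submodule.span ℝ {((1 : ℝ), B y)})

theorem mem_lineFiber_iff {m : ℕ}
    {B : EuclideanSpace ℝ (Fin (2 * m)) →ₗ[ℝ] EuclideanSpace ℝ (Fin (2 * m))}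
    {y : EuclideanSpace ℝ (Fin (2 * m))} {p : ℝ × EuclideanSpace ℝ (Fin (2 * m))} :
    p ∈ lineFiber B y ↔ p.2 = y + p.1 • B y := by
  obtain ⟨t, z⟩ := p
  simp only [lineFiber, AffineSubspace.mem_mk', Submodule.mem_span_singleton, vsub_eq_sub,
    Prod.mk_sub_mk, Prod.smul_mk, Prod.mk.injEq, smul_eq_mul, mul_one, sub_zero]
  constructor
  · rintro ⟨a, rfl, h⟩
    rw [h]
    abel
  · rintro rfl
    exact ⟨t, rfl, by abel⟩

theorem injective_id_add_smul_of_forall_ne_smul {E : Type*} [AddCommGroup E] [Module ℝ E]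
    {B : E →ₗ[ℝ] E} (hB : ∀ (μ : ℝ) (v : E), v ≠ 0 → B v ≠ μ • v) (t : ℝ) :
    Function.Injective (LinearMap.id (R := ℝ) (M := E) + t • B) := by
  rw [injective_iff_map_eq_zero]
  intro v hv
  by_contra hne
  have hv' : v + t • B v = 0 := by simpa using hv
  have ht : t ≠ 0 := by
    rintro rfl
    exact hne (by simpa using hv')
  refine hB (-t⁻¹) v hne ?_
  rw [neg_smul, ← smul_neg, eq_inv_smul_iff₀ ht]
  exact eq_neg_of_add_eq_zero_right hv'

theorem disjoint_lineFiber_of_forall_ne_smul {m : ℕ}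
    {B : EuclideanSpace ℝ (Fin (2 * m)) →ₗ[ℝ] EuclideanSpace ℝ (Fin (2 * m))}
    (hB : ∀ (μ : ℝ) (v : EuclideanSpace ℝ (Fin (2 * m))), v ≠ 0 → B v ≠ μ • v)
    {x y : EuclideanSpace ℝ (Fin (2 * m))} (hxy : x ≠ y) :
    Disjoint (lineFiber B x : Set (ℝ × EuclideanSpace ℝ (Fin (2 * m))))
      (lineFiber B y : Set (ℝ × EuclideanSpace ℝ (Fin (2 * m)))) := by
  rw [Set.disjoint_left]
  intro p hpx hpy
  rw [SetLike.mem_coe, mem_lineFiber_iff] at hpx hpy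
  exact hxy (injective_id_add_smul_of_forall_ne_smul hB p.1 (by simp [← hpx, ← hpy]))

theorem direction_lineFiber_inf_eq_bot_of_injective {m : ℕ}
    {B : EuclideanSpace ℝ (Fin (2 * m)) →ₗ[ℝ] EuclideanSpace ℝ (Fin (2 * m))}
    (hB : Function.Injective B) {x y : EuclideanSpace ℝ (Fin (2 * m))} (hxy : x ≠ y) :
    (lineFiber B x).direction ⊓ (lineFiber B y).direction = ⊥ := by
  rw [eq_bot_iff]
  rintro p ⟨hx, hy⟩
  simp only [lineFiber, AffineSubspace.direction_mk', SetLike.mem_coe,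
    Submodule.mem_span_singleton] at hx hy
  obtain ⟨a, rfl⟩ := hx
  obtain ⟨b, hb⟩ := hy
  simp only [Prod.smul_mk, Prod.mk.injEq, smul_eq_mul, mul_one] at hb
  obtain ⟨rfl, hb⟩ := hb
  by_cases h : b = 0
  · simp [h]
  · exact absurd (hB (smul_right_injective _ h hb)).symm hxy

theorem exists_mem_lineFiber_of_forall_ne_smul {m : ℕ}
    {B : EuclideanSpace ℝ (Fin (2 * m)) →ₗ[ℝ] EuclideanSpace ℝ (Fin (2 * m))}
    (hB : ∀ (μ : ℝ) (v : EuclideanSpace ℝ (Fin (2 * m))), v ≠ 0 → B v ≠ μ • v)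
    (p : ℝ × EuclideanSpace ℝ (Fin (2 * m))) : ∃ y, p ∈ lineFiber B y := by
  obtain ⟨y, hy⟩ := LinearMap.injective_iff_surjective.mp
    (injective_id_add_smul_of_forall_ne_smul hB p.1) p.2
  exact ⟨y, mem_lineFiber_iff.mpr (by simp [← hy])⟩

/-- A `4 × 4` tridiagonal block with characteristic polynomial `X ^ 4 + 1`, whose first row is the
transpose of its first column, followed by `2 × 2` rotation blocks. Indices are read modulo `n`. -/
noncomputable def tridiagonalRotation (n : ℕ) [NeZero n] :
    EuclideanSpace ℝ (Fin n) →ₗ[ℝ] EuclideanSpace ℝ (Fin n) where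
  toFun v := WithLp.toLp 2 fun i =>
    if i.val = 0 then v (Fin.ofNat n 1)
    else if i.val = 1 then v (Fin.ofNat n 0) + v (Fin.ofNat n 2)
    else if i.val = 2 then -2 * v (Fin.ofNat n 1) + v (Fin.ofNat n 3)
    else if i.val = 3 then v (Fin.ofNat n 2)
    else if i.val % 2 = 0 then v (Fin.ofNat n (i.val + 1))
    else -v (Fin.ofNat n (i.val - 1))
  map_add' v w := by
    ext i
    simp only [PiLp.add_apply]
    split_ifs <;> ring
  map_smul' a v := by
    ext i
    simp only [PiLp.smul_apply, smul_eq_mul, RingHom.id_apply]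
    split_ifs <;> ring

theorem tridiagonalRotation_apply {n : ℕ} [NeZero n] (v : EuclideanSpace ℝ (Fin n)) (i : Fin n) :
    tridiagonalRotation n v i =
      if i.val = 0 then v (Fin.ofNat n 1)
      else if i.val = 1 then v (Fin.ofNat n 0) + v (Fin.ofNat n 2)
      else if i.val = 2 then -2 * v (Fin.ofNat n 1) + v (Fin.ofNat n 3)
      else if i.val = 3 then v (Fin.ofNat n 2)
      else if i.val % 2 = 0 then v (Fin.ofNat n (i.val + 1))
      else -v (Fin.ofNat n (i.val - 1)) :=
  rfl

theorem tridiagonalRotation_ne_smul {n : ℕ} [NeZero n] (hn : 4 ≤ n) (heven : Even n) (μ : ℝ)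
    (v : EuclideanSpace ℝ (Fin n)) (hv : v ≠ 0) : tridiagonalRotation n v ≠ μ • v := by
  intro h
  apply hv
  have key (k : ℕ) :
      tridiagonalRotation n v (Fin.ofNat n k) = μ * v (Fin.ofNat n k) := by
    rw [h, PiLp.smul_apply, smul_eq_mul]
  have val (k : ℕ) (hk : k < n) : (Fin.ofNat n k).val = k := Nat.mod_eq_of_lt hk
  have e0 := key 0
  have e1 := key 1
  have e2 := key 2
  have e3 := key 3
  rw [tridiagonalRotation_apply, val _ (by lia)] at e0 e1 e2 e3
  norm_num only [if_true, if_false] at e0 e1 e2 e3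
  have h0 : v (Fin.ofNat n 0) = 0 := by
    have : (μ ^ 4 + 1) * v (Fin.ofNat n 0) = 0 := by
      linear_combination (-(μ ^ 3 + μ)) * e0 - (μ ^ 2 - 1) * e1 - μ * e2 - e3
    exact (mul_eq_zero.mp this).resolve_left (by positivity)
  have h1 : v (Fin.ofNat n 1) = 0 := by rw [e0, h0, mul_zero]
  have h2 : v (Fin.ofNat n 2) = 0 := by linear_combination e1 - h0 + μ * h1
  have h3 : v (Fin.ofNat n 3) = 0 := by linear_combination e2 + 2 * h1 + μ * h2
  have hpair (k : ℕ) (hk : 4 ≤ k) (hkn : k + 1 < n) (hk2 : k % 2 = 0) :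
      v (Fin.ofNat n k) = 0 ∧ v (Fin.ofNat n (k + 1)) = 0 := by
    have ek := key k
    have ek' := key (k + 1)
    rw [tridiagonalRotation_apply, val _ (by lia), if_neg (by lia), if_neg (by lia),
      if_neg (by lia), if_neg (by lia)] at ek ek'
    rw [if_pos hk2] at ek
    rw [if_neg (by lia), Nat.add_sub_cancel] at ek'
    have hz : v (Fin.ofNat n k) = 0 := by
      have : (μ ^ 2 + 1) * v (Fin.ofNat n k) = 0 := by linear_combination -ek' - μ * ek
      exact (mul_eq_zero.mp this).resolve_left (by positivity)
    exact ⟨hz, by rw [ek, hz, mul_zero]⟩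
  ext i
  obtain ⟨k, hk⟩ := i
  have hi : (⟨k, hk⟩ : Fin n) = Fin.ofNat n k := Fin.ext (val k hk).symm
  rw [hi, PiLp.zero_apply]
  obtain ⟨r, hr⟩ := heven
  rcases lt_or_ge k 4 with h4 | h4
  · interval_cases k <;> assumption
  · rcases Nat.mod_two_eq_zero_or_one k with hk2 | hk2
    · exact (hpair k h4 (by lia) hk2).1
    · have := (hpair (k - 1) (by lia) (by lia) (by lia)).2
      rwa [Nat.sub_add_cancel (by lia)] at this

theorem not_injective_tridiagonalRotation_sub_adjoint {n : ℕ} [NeZero n] (hn : 4 ≤ n)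
    (heven : Even n) :
    ¬ Function.Injective (tridiagonalRotation n - LinearMap.adjoint (tridiagonalRotation n)) := by
  intro h
  obtain ⟨r, hr⟩ := heven
  have hcol : tridiagonalRotation n (EuclideanSpace.single 0 1) =
      EuclideanSpace.single (Fin.ofNat n 1) 1 := by
    ext i
    have hi : i = Fin.ofNat n 1 ↔ i.val = 1 := by
      rw [Fin.ext_iff, Fin.val_ofNat, Nat.mod_eq_of_lt (by lia)]
    have hz (k : ℕ) (hk : k < n) : Fin.ofNat n k = 0 ↔ k = 0 := by
      rw [Fin.ext_iff, Fin.val_ofNat, Nat.mod_eq_of_lt hk, Fin.val_zero]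
    rw [tridiagonalRotation_apply]
    simp only [PiLp.single_apply, hi, hz 0 (by lia), hz 1 (by lia), hz 2 (by lia), hz 3 (by lia)]
    by_cases hlast : i.val + 1 < n
    · simp only [hz (i.val + 1) hlast, hz (i.val - 1) (by lia)]
      split_ifs <;> first | lia | norm_num
    · simp only [hz (i.val - 1) (by lia)]
      split_ifs <;> first | lia | norm_num
  have hzero : (tridiagonalRotation n - LinearMap.adjoint (tridiagonalRotation n))
      (EuclideanSpace.single 0 1) = 0 := by
    rw [LinearMap.sub_apply, sub_eq_zero]
    refine ext_inner_left ℝ fun w => ?_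
    rw [LinearMap.adjoint_inner_right, hcol, EuclideanSpace.inner_single_right,
      EuclideanSpace.inner_single_right, tridiagonalRotation_apply, if_pos (Fin.val_zero n)]
  have := (injective_iff_map_eq_zero _).mp h _ hzero
  simp at this

theorem exists_noncontact_nondegenerate_line_fibration (m : ℕ) (hm : 2 ≤ m) :
    ∃ B : EuclideanSpace ℝ (Fin (2 * m)) →ₗ[ℝ] EuclideanSpace ℝ (Fin (2 * m)),
      -- (i) B has no real eigenvalues
      (∀ (μ : ℝ) (v : EuclideanSpace ℝ (Fin (2 * m))), v ≠ 0 → B v ≠ μ • v) ∧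
      -- (ii) the lines L_y are pairwise skew and fill all of ℝ × ℝ^(2m)
      (∀ x y : EuclideanSpace ℝ (Fin (2 * m)), x ≠ y →
        Disjoint (lineFiber B x : Set (ℝ × EuclideanSpace ℝ (Fin (2 * m))))
          (lineFiber B y : Set (ℝ × EuclideanSpace ℝ (Fin (2 * m)))) ∧
        (lineFiber B x).direction ⊓ (lineFiber B y).direction = ⊥) ∧
      (∀ p : ℝ × EuclideanSpace ℝ (Fin (2 * m)),
        ∃ y : EuclideanSpace ℝ (Fin (2 * m)), p ∈ lineFiber B y) ∧
      -- (iii) B − B† is not injective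
      ¬ Function.Injective (B - LinearMap.adjoint B) := by
  have : NeZero (2 * m) := ⟨by lia⟩
  have hB := tridiagonalRotation_ne_smul (n := 2 * m) (by lia) (even_two_mul m)
  refine ⟨tridiagonalRotation (2 * m), hB, fun x y hxy =>
    ⟨disjoint_lineFiber_of_forall_ne_smul hB hxy,
      direction_lineFiber_inf_eq_bot_of_injective ?_ hxy⟩,
    exists_mem_lineFiber_of_forall_ne_smul hB,
    not_injective_tridiagonalRotation_sub_adjoint (by lia) (even_two_mul m)⟩
  rw [injective_iff_map_eq_zero]
  intro v hv
  by_contra hne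
  exact hB 0 v hne (by rw [hv, zero_smul])
end

section
/- Let P and Q be nonempty affine subspaces of EuclideanSpace ℝ (Fin n), and let α(P) and α(Q) be the linear spans in (EuclideanSpace ℝ (Fin n)) × ℝ of {(p, 1) : p ∈ P} and {(p, 1) : p ∈ Q} respectively. Then P and Q are skew (disjoint as sets, with P.direction ⊓ Q.direction = ⊥) if and only if α(P) ⊓ α(Q) = ⊥. -/
open Metric Module

/-- `α(Q)`: the linear span in `ℝ^n × ℝ` of `{(p, 1) : p ∈ Q}`. -/
noncomputable def alphaSpan {n : ℕ} (Q : AffineSubspace ℝ (EuclideanSpace ℝ (Fin n))) :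
    Submodule ℝ (EuclideanSpace ℝ (Fin n) × ℝ) :=
  Submodule.span ℝ ((fun p => (p, (1 : ℝ))) '' (Q : Set (EuclideanSpace ℝ (Fin n))))

theorem mem_alphaSpan_iff {n : ℕ} {Q : AffineSubspace ℝ (EuclideanSpace ℝ (Fin n))}
    {q : EuclideanSpace ℝ (Fin n)} (hq : q ∈ Q) (x : EuclideanSpace ℝ (Fin n) × ℝ) :
    x ∈ alphaSpan Q ↔ x.1 - x.2 • q ∈ Q.direction := by
  constructor
  · intro hx
    induction hx using Submodule.span_induction with
    | mem x hx =>
      obtain ⟨p, hp, rfl⟩ := hx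
      simpa using AffineSubspace.vsub_mem_direction hp hq
    | zero => simp
    | add x y _ _ hx hy =>
      convert Q.direction.add_mem hx hy using 1
      simp only [Prod.fst_add, Prod.snd_add]
      module
    | smul a x _ hx =>
      convert Q.direction.smul_mem a hx using 1
      simp only [Prod.smul_fst, Prod.smul_snd, smul_eq_mul]
      module
  · intro hx
    have hmem : ∀ p ∈ Q, (p, (1 : ℝ)) ∈ alphaSpan Q := fun p hp =>
      Submodule.subset_span ⟨p, hp, rfl⟩
    have hp : x.1 - x.2 • q + q ∈ Q := AffineSubspace.vadd_mem_of_mem_direction hx hq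
    convert (alphaSpan Q).add_mem (hmem _ hp)
      ((alphaSpan Q).smul_mem (x.2 - 1) (hmem q hq)) using 1
    ext1
    · simp only [Prod.fst_add, Prod.smul_fst]
      module
    · simp

theorem mk_one_mem_alphaSpan_iff {n : ℕ} {Q : AffineSubspace ℝ (EuclideanSpace ℝ (Fin n))}
    (hQ : (Q : Set (EuclideanSpace ℝ (Fin n))).Nonempty) (p : EuclideanSpace ℝ (Fin n)) :
    (p, (1 : ℝ)) ∈ alphaSpan Q ↔ p ∈ Q := by
  obtain ⟨q, hq⟩ := hQ
  rw [mem_alphaSpan_iff hq, one_smul]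
  exact AffineSubspace.vsub_right_mem_direction_iff_mem hq p

theorem mk_zero_mem_alphaSpan_iff {n : ℕ} {Q : AffineSubspace ℝ (EuclideanSpace ℝ (Fin n))}
    (hQ : (Q : Set (EuclideanSpace ℝ (Fin n))).Nonempty) (v : EuclideanSpace ℝ (Fin n)) :
    (v, (0 : ℝ)) ∈ alphaSpan Q ↔ v ∈ Q.direction := by
  obtain ⟨q, hq⟩ := hQ
  rw [mem_alphaSpan_iff hq, zero_smul, sub_zero]

theorem skew_iff_alpha_inf_bot (n : ℕ)
    (P Q : AffineSubspace ℝ (EuclideanSpace ℝ (Fin n)))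
    (hP : (P : Set (EuclideanSpace ℝ (Fin n))).Nonempty)
    (hQ : (Q : Set (EuclideanSpace ℝ (Fin n))).Nonempty) :
    (Disjoint (P : Set (EuclideanSpace ℝ (Fin n))) (Q : Set (EuclideanSpace ℝ (Fin n))) ∧
        P.direction ⊓ Q.direction = ⊥) ↔
      alphaSpan P ⊓ alphaSpan Q = ⊥ := by
  simp only [Submodule.eq_bot_iff, Submodule.mem_inf, Set.disjoint_left, SetLike.mem_coe]
  constructor
  · rintro ⟨hdisj, hdir⟩ ⟨v, t⟩ ⟨hxP, hxQ⟩
    rcases eq_or_ne t 0 with rfl | ht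
    · rw [mk_zero_mem_alphaSpan_iff hP] at hxP
      rw [mk_zero_mem_alphaSpan_iff hQ] at hxQ
      rw [hdir v ⟨hxP, hxQ⟩, Prod.mk_zero_zero]
    · have hscale : t⁻¹ • (v, t) = (t⁻¹ • v, (1 : ℝ)) := by simp [ht]
      have hp := (alphaSpan P).smul_mem t⁻¹ hxP
      have hq := (alphaSpan Q).smul_mem t⁻¹ hxQ
      rw [hscale, mk_one_mem_alphaSpan_iff hP] at hp
      rw [hscale, mk_one_mem_alphaSpan_iff hQ] at hq
      exact absurd hq (hdisj hp)
  · intro h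
    refine ⟨fun p hp hq => ?_, fun v hv => ?_⟩
    · have h₁ := h (p, 1) ⟨(mk_one_mem_alphaSpan_iff hP p).2 hp,
        (mk_one_mem_alphaSpan_iff hQ p).2 hq⟩
      exact one_ne_zero (congrArg Prod.snd h₁)
    · exact congrArg Prod.fst (h (v, 0) ⟨(mk_zero_mem_alphaSpan_iff hP v).2 hv.1,
        (mk_zero_mem_alphaSpan_iff hQ v).2 hv.2⟩)
end

section
/- Let m ≥ 1 and let B : EuclideanSpace ℝ (Fin (2m)) →ₗ[ℝ] EuclideanSpace ℝ (Fin (2m)) be a linear map with no real eigenvalues (for every μ ∈ ℝ and every v ≠ 0, B v ≠ μ • v) which is invariant on planes: for every u, B (B u) lies in the linear span of {u, B u}. Then there exist real numbers a and b with b ≠ 0 such that B ∘ B = 2a • B − (a² + b²) • id; equivalently, all complex eigenvalues of B are equal to a + bi or a − bi and B satisfies the quadratic polynomial X² − 2aX + (a² + b²). -/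
open Metric Module

section NoRealEigenvalues

variable {V : Type*} [AddCommGroup V] [Module ℝ V] {B : V →ₗ[ℝ] V}

theorem eq_zero_of_smul_add_smul_apply_eq_zero
    (hB : ∀ (μ : ℝ) (v : V), v ≠ 0 → B v ≠ μ • v) {x : V} (hx : x ≠ 0) {α β : ℝ}
    (h : α • x + β • B x = 0) : α = 0 ∧ β = 0 := by
  have hβ : β = 0 := by
    by_contra hβ
    apply hB (-(β⁻¹ * α)) x hx
    have h' : β • B x = -(α • x) := eq_neg_of_add_eq_zero_right h
    rw [← inv_smul_smul₀ hβ (B x), h', smul_neg, smul_smul, neg_smul]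
  subst hβ
  simpa [hx] using h

theorem coeff_unique
    (hB : ∀ (μ : ℝ) (v : V), v ≠ 0 → B v ≠ μ • v) {x : V} (hx : x ≠ 0) {c d c' d' : ℝ}
    (h : B (B x) = c • x + d • B x) (h' : B (B x) = c' • x + d' • B x) : c = c' ∧ d = d' := by
  have key : (c - c') • x + (d - d') • B x = 0 := by
    linear_combination (norm := module) h' - h
  obtain ⟨h₁, h₂⟩ := eq_zero_of_smul_add_smul_apply_eq_zero hB hx key
  exact ⟨sub_eq_zero.mp h₁, sub_eq_zero.mp h₂⟩

theorem apply_apply_smul_add_smul_apply {u : V} {c d : ℝ}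
    (h : B (B u) = c • u + d • B u) (α β : ℝ) :
    B (B (α • u + β • B u)) = c • (α • u + β • B u) + d • B (α • u + β • B u) := by
  simp only [map_add, map_smul, h]
  module

theorem coeff_eq_coeff
    (hB : ∀ (μ : ℝ) (v : V), v ≠ 0 → B v ≠ μ • v)
    (hinv : ∀ u : V, B (B u) ∈ Submodule.span ℝ {u, B u})
    {u v : V} (hu : u ≠ 0) (hv : v ≠ 0) {c d c' d' : ℝ}
    (h : B (B u) = c • u + d • B u) (h' : B (B v) = c' • v + d' • B v) : c = c' ∧ d = d' := by
  obtain ⟨p, q, hpq⟩ := Submodule.mem_span_pair.mp (hinv (u + v))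
  have hx : (c - p) • u + (d - q) • B u = (p - c') • v + (q - d') • B v := by
    simp only [map_add, h, h'] at hpq
    linear_combination (norm := module) -hpq
  by_cases h0 : (c - p) • u + (d - q) • B u = 0
  · obtain ⟨h₁, h₂⟩ := eq_zero_of_smul_add_smul_apply_eq_zero hB hu h0
    obtain ⟨h₃, h₄⟩ := eq_zero_of_smul_add_smul_apply_eq_zero hB hv (hx.symm.trans h0)
    constructor <;> linarith
  · refine coeff_unique hB h0 (apply_apply_smul_add_smul_apply h _ _) ?_
    rw [hx]
    exact apply_apply_smul_add_smul_apply h' _ _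

theorem discrim_neg_of_no_real_eigenvalue
    (hB : ∀ (μ : ℝ) (v : V), v ≠ 0 → B v ≠ μ • v) {u : V} (hu : u ≠ 0) {c d : ℝ}
    (h : B (B u) = c • u + d • B u) : (d / 2) ^ 2 + c < 0 := by
  by_contra! hc
  set s := √((d / 2) ^ 2 + c)
  have hs : s ^ 2 = (d / 2) ^ 2 + c := Real.sq_sqrt hc
  refine hB (d / 2 + s) (B u - (d / 2 - s) • u) (sub_ne_zero.mpr (hB _ u hu)) ?_
  have hc' : c = s ^ 2 - (d / 2) ^ 2 := by linarith
  rw [map_sub, map_smul, h, hc']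
  module

end NoRealEigenvalues

theorem invariant_on_planes_quadratic (m : ℕ) (hm : 1 ≤ m)
    (B : EuclideanSpace ℝ (Fin (2 * m)) →ₗ[ℝ] EuclideanSpace ℝ (Fin (2 * m)))
    (hnoreal : ∀ (μ : ℝ) (v : EuclideanSpace ℝ (Fin (2 * m))), v ≠ 0 → B v ≠ μ • v)
    (hinv : ∀ u : EuclideanSpace ℝ (Fin (2 * m)), B (B u) ∈ Submodule.span ℝ {u, B u}) :
    ∃ a b : ℝ, b ≠ 0 ∧
      B.comp B = (2 * a) • B - (a ^ 2 + b ^ 2) •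
        (LinearMap.id : EuclideanSpace ℝ (Fin (2 * m)) →ₗ[ℝ] EuclideanSpace ℝ (Fin (2 * m))) := by
  have : Nonempty (Fin (2 * m)) := ⟨⟨0, by omega⟩⟩
  obtain ⟨u, hu⟩ := exists_ne (0 : EuclideanSpace ℝ (Fin (2 * m)))
  obtain ⟨c, d, h⟩ := Submodule.mem_span_pair.mp (hinv u)
  have hneg := discrim_neg_of_no_real_eigenvalue hnoreal hu h.symm
  have hpos : 0 < -((d / 2) ^ 2 + c) := neg_pos.mpr hneg
  refine ⟨d / 2, √(-((d / 2) ^ 2 + c)), (Real.sqrt_pos.mpr hpos).ne', LinearMap.ext fun v => ?_⟩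
  rw [Real.sq_sqrt hpos.le]
  simp only [LinearMap.comp_apply, LinearMap.sub_apply, LinearMap.smul_apply, LinearMap.id_apply]
  rcases eq_or_ne v 0 with rfl | hv
  · simp
  obtain ⟨c', d', h'⟩ := Submodule.mem_span_pair.mp (hinv v)
  obtain ⟨rfl, rfl⟩ := coeff_eq_coeff hnoreal hinv hu hv h.symm h'.symm
  rw [← h']
  module
end
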